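/- Let G be a group, H a subgroup of G of index 2, k an algebraically closed field, and ξ : H → kˣ a group homomorphism with ξ(g h g⁻¹) = ξ(h) for all g ∈ G, h ∈ H (ξ is irregular). If char k ≠ 2, then Ind_H^G ξ is isomorphic to the direct sum λ₁ ⊕ λ₂ of the two distinct group homomorphisms λ₁, λ₂ : G → kˣ extending ξ. If char k = 2, then, letting λ : G → kˣ be the unique homomorphism extending ξ, there is a short exact sequence of G-representations 0 → λ → Ind_H^G ξ → λ → 0 which does not split; in particular Ind_H^G ξ is not semisimple and both of its composition factors equal λ. -/

import Mathlib

section IndDef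

variable {G : Type*} [Group G] (H : Subgroup G) (k : Type*) [Field k] (ξ : H →* kˣ)

/-- The space of the induced representation of the character `ξ` from `H` to `G`:
functions `f : G → k` with `f (h * g) = ξ h * f g`. -/
def indCar : Submodule k (G → k) where
  carrier := {f | ∀ (h : H) (g : G), f (↑h * g) = (ξ h : k) * f g}
  add_mem' := by
    intro a b ha hb h g
    simp only [Set.mem_setOf_eq, Pi.add_apply] at *
    rw [ha h g, hb h g]; ring
  zero_mem' := by intro h g; simp
  smul_mem' := by
    intro c f hf h g
    simp only [Set.mem_setOf_eq, Pi.smul_apply, smul_eq_mul] at *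
    rw [hf h g]; ring

/-- The induced representation `Ind_H^G ξ`, with `G` acting by right translation:
`(g • f) x = f (x * g)`. -/
def indRep : Representation k G (indCar H k ξ) where
  toFun g :=
    { toFun := fun f => ⟨fun x => (f : G → k) (x * g), by
        intro h x
        simpa [mul_assoc] using f.2 h (x * g)⟩
      map_add' := by intro f₁ f₂; apply Subtype.ext; funext x; simp
      map_smul' := by intro c f; apply Subtype.ext; funext x; simp }
  map_one' := by
    apply LinearMap.ext; intro f; apply Subtype.ext; funext x; simp
  map_mul' := by
    intro g₁ g₂
    apply LinearMap.ext; intro f; apply Subtype.ext; funext x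
    simp [mul_assoc]

/-- Isomorphism of representations. -/
def RepIso {M : Type*} [Monoid M] {k : Type*} [CommSemiring k] {V W : Type*}
    [AddCommMonoid V] [Module k V] [AddCommMonoid W] [Module k W]
    (ρ : Representation k M V) (τ : Representation k M W) : Prop :=
  ∃ e : V ≃ₗ[k] W, ∀ (g : M) (v : V), e (ρ g v) = τ g (e v)

/-- Irreducibility of a representation: the space is nonzero and the only invariant
subspaces are `⊥` and `⊤`. -/
def IsIrredRep {M : Type*} [Monoid M] {k : Type*} [CommSemiring k] {V : Type*}
    [AddCommMonoid V] [Module k V] (ρ : Representation k M V) : Prop :=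
  Nontrivial V ∧ ∀ W : Submodule k V, (∀ g : M, ∀ v ∈ W, ρ g v ∈ W) → W = ⊥ ∨ W = ⊤

/-- The conjugate character `ξ^g : h ↦ ξ (g * h * g⁻¹)` of a normal subgroup. -/
def conjChar [H.Normal] (g : G) : H →* kˣ :=
  ξ.comp (MulAut.conjNormal g).toMonoidHom

theorem conjChar_apply [H.Normal] (g : G) (h : H)
    (hm : g * ↑h * g⁻¹ ∈ H) : conjChar H k ξ g h = ξ ⟨g * ↑h * g⁻¹, hm⟩ := by
  have h1 : (MulAut.conjNormal g h : H) = ⟨g * ↑h * g⁻¹, hm⟩ := by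
    ext; simp
  show ξ (MulAut.conjNormal g h) = _
  rw [h1]

end IndDef

/-- The direct sum of two one-dimensional representations given by the characters
`lam₁, lam₂ : M → kˣ`, realized on `k × k`. -/
def charPairRep {M : Type*} [Monoid M] (k : Type*) [Field k] (lam₁ lam₂ : M →* kˣ) :
    Representation k M (k × k) where
  toFun g := LinearMap.prodMap ((lam₁ g : k) • LinearMap.id) ((lam₂ g : k) • LinearMap.id)
  map_one' := by
    apply LinearMap.ext; intro v
    simp
  map_mul' g₁ g₂ := by
    apply LinearMap.ext; intro v
    apply Prod.ext <;> simp [mul_smul]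

section IndexTwo

variable {G : Type*} [Group G] {H : Subgroup G} {k : Type*} [Field k] {ξ : H →* kˣ}

theorem mul_inv_mem_of_index_two (hidx : H.index = 2) {g s : G} (hg : g ∉ H) (hs : s ∉ H) :
    g * s⁻¹ ∈ H := by
  rw [Subgroup.mul_mem_iff_of_index_two hidx, inv_mem_iff]
  tauto

theorem mul_mem_of_notMem_of_index_two (hidx : H.index = 2) {g s : G} (hg : g ∉ H)
    (hs : s ∉ H) : g * s ∈ H := by
  rw [Subgroup.mul_mem_iff_of_index_two hidx]
  tauto

/-- A conjugation-invariant character of an index-2 subgroup extends to the whole group, with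
any prescribed value at `s ∉ H` whose square is `ξ (s * s)`. -/
theorem exists_extension_of_index_two (hidx : H.index = 2)
    (hinv : ∀ (g : G) (h : H) (hm : g * ↑h * g⁻¹ ∈ H), ξ ⟨g * ↑h * g⁻¹, hm⟩ = ξ h)
    {s : G} (hs : s ∉ H) (hss : s * s ∈ H) {u : kˣ} (hu : u * u = ξ ⟨s * s, hss⟩) :
    ∃ lam : G →* kˣ, (∀ h : H, lam ↑h = ξ h) ∧ lam s = u := by
  classical
  have hmul (a b : G) (ha : a ∈ H) (hb : b ∈ H) (hab : a * b ∈ H) :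
      ξ ⟨a * b, hab⟩ = ξ ⟨a, ha⟩ * ξ ⟨b, hb⟩ := by
    rw [← map_mul]; rfl
  have hcongr (a b : G) (h : a = b) (ha : a ∈ H) (hb : b ∈ H) : ξ ⟨a, ha⟩ = ξ ⟨b, hb⟩ := by
    subst h; rfl
  have hN : H.Normal := Subgroup.normal_of_index_eq_two hidx
  let lam : G → kˣ := fun g =>
    if hg : g ∈ H then ξ ⟨g, hg⟩ else ξ ⟨g * s⁻¹, mul_inv_mem_of_index_two hidx hg hs⟩ * u
  have hpos (g : G) (hg : g ∈ H) : lam g = ξ ⟨g, hg⟩ := dif_pos hg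
  have hneg (g : G) (hg : g ∉ H) :
      lam g = ξ ⟨g * s⁻¹, mul_inv_mem_of_index_two hidx hg hs⟩ * u := dif_neg hg
  have lam_one : lam 1 = 1 := by rw [hpos 1 H.one_mem]; exact map_one ξ
  refine ⟨⟨⟨lam, lam_one⟩, fun a b => ?_⟩, fun h => hpos h h.2, ?_⟩
  · change lam (a * b) = lam a * lam b
    have hab := Subgroup.mul_mem_iff_of_index_two hidx (a := a) (b := b)
    by_cases ha : a ∈ H <;> by_cases hb : b ∈ H
    · rw [hpos _ (hab.2 (by tauto)), hpos _ ha, hpos _ hb, hmul]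
    · rw [hneg _ (by tauto), hpos _ ha, hneg _ hb, ← mul_assoc, ← hmul]
      · congr 1
        exact hcongr _ _ (by group) _ _
      · exact H.mul_mem ha (mul_inv_mem_of_index_two hidx hb hs)
    · have has := mul_inv_mem_of_index_two hidx ha hs
      have hc : s * b * s⁻¹ ∈ H := hN.conj_mem b hb s
      rw [hneg _ (by tauto), hneg _ ha, hpos _ hb, mul_right_comm, ← hinv s ⟨b, hb⟩ hc,
        ← hmul _ _ has hc (H.mul_mem has hc)]
      congr 1
      exact hcongr _ _ (by group) _ _
    · have has := mul_inv_mem_of_index_two hidx ha hs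
      have hbs := mul_inv_mem_of_index_two hidx hb hs
      have hc : s * (b * s⁻¹) * s⁻¹ ∈ H := hN.conj_mem _ hbs s
      rw [hpos _ (hab.2 (by tauto)), hneg _ ha, hneg _ hb, mul_mul_mul_comm, hu,
        ← hinv s ⟨b * s⁻¹, hbs⟩ hc, ← hmul _ _ has hc (H.mul_mem has hc),
        ← hmul _ _ (H.mul_mem has hc) hss (H.mul_mem (H.mul_mem has hc) hss)]
      exact hcongr _ _ (by group) _ _
  · change lam s = u
    have h1 : ξ ⟨s * s⁻¹, mul_inv_mem_of_index_two hidx hs hs⟩ = 1 := by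
      rw [hcongr _ 1 (by group) _ H.one_mem]
      exact map_one ξ
    rw [hneg s hs, h1, one_mul]

theorem eq_of_eqOn_of_index_two {M : Type*} [MulOneClass M] (hidx : H.index = 2) {s : G}
    (hs : s ∉ H) {lam mu : G →* M} (hH : ∀ h ∈ H, lam h = mu h) (h : lam s = mu s) :
    lam = mu := by
  ext g
  by_cases hg : g ∈ H
  · exact hH g hg
  · rw [← inv_mul_cancel_right g s, map_mul lam (g * s⁻¹), map_mul mu (g * s⁻¹), h,
      hH _ (mul_inv_mem_of_index_two hidx hg hs)]

/-- An extension of `ξ` to `G`, viewed as an element of `Ind_H^G ξ`. -/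
def indCarOfChar (lam : G →* kˣ) (hlam : ∀ h : H, lam ↑h = ξ h) : indCar H k ξ :=
  ⟨fun g => (lam g : k), fun h g => by simp [hlam]⟩

theorem indRep_indCarOfChar (lam : G →* kˣ) (hlam : ∀ h : H, lam ↑h = ξ h) (g : G) :
    indRep H k ξ g (indCarOfChar lam hlam) = (lam g : k) • indCarOfChar lam hlam := by
  apply Subtype.ext
  funext x
  change ((lam (x * g) : kˣ) : k) = (lam g : k) * (lam x : k)
  rw [map_mul, Units.val_mul, mul_comm]

variable (H ξ) in
open Classical in
/-- The element of `Ind_H^G ξ` supported on `H` and equal to `ξ` there. -/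
noncomputable def indCarDelta : indCar H k ξ :=
  ⟨fun g => if hg : g ∈ H then (ξ ⟨g, hg⟩ : k) else 0, fun h g => by
    beta_reduce
    by_cases hg : g ∈ H
    · rw [dif_pos hg, dif_pos (H.mul_mem h.2 hg), ← Units.val_mul, ← map_mul]; rfl
    · rw [dif_neg hg, dif_neg (by rwa [H.mul_mem_cancel_left h.2]), mul_zero]⟩

theorem indCarDelta_one : (indCarDelta H ξ).1 1 = 1 :=
  (dif_pos H.one_mem).trans (congrArg Units.val (map_one ξ))

theorem indCarDelta_of_notMem {g : G} (hg : g ∉ H) : (indCarDelta H ξ).1 g = 0 :=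
  dif_neg hg

theorem indCar_apply_mul {lam : G →* kˣ} (hlam : ∀ h : H, lam ↑h = ξ h) (f : indCar H k ξ)
    {h : G} (hh : h ∈ H) (g : G) : f.1 (h * g) = (lam h : k) * f.1 g := by
  rw [f.2 ⟨h, hh⟩ g, ← hlam]

theorem indCar_apply_of_notMem (hidx : H.index = 2) {lam : G →* kˣ}
    (hlam : ∀ h : H, lam ↑h = ξ h) (f : indCar H k ξ) {g s : G} (hg : g ∉ H) (hs : s ∉ H) :
    f.1 g = (lam (g * s⁻¹) : k) * f.1 s := by
  rw [← indCar_apply_mul hlam f (mul_inv_mem_of_index_two hidx hg hs), inv_mul_cancel_right]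

theorem indCar_apply_of_mem {lam : G →* kˣ} (hlam : ∀ h : H, lam ↑h = ξ h) (f : indCar H k ξ)
    {g : G} (hg : g ∈ H) : f.1 g = (lam g : k) * f.1 1 := by
  rw [← indCar_apply_mul hlam f hg, mul_one]

theorem indCar_ext (hidx : H.index = 2) {lam : G →* kˣ} (hlam : ∀ h : H, lam ↑h = ξ h)
    {s : G} (hs : s ∉ H) {f f' : indCar H k ξ} (h1 : f.1 1 = f'.1 1) (h2 : f.1 s = f'.1 s) :
    f = f' := by
  apply Subtype.ext
  funext g
  by_cases hg : g ∈ H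
  · rw [indCar_apply_of_mem hlam f hg, indCar_apply_of_mem hlam f' hg, h1]
  · rw [indCar_apply_of_notMem hidx hlam f hg hs, indCar_apply_of_notMem hidx hlam f' hg hs, h2]

variable (H ξ) in
/-- The functional `f ↦ f 1 + λ(s)⁻¹ f s` on `Ind_H^G ξ`; if `λ` extends `ξ` and `s ∉ H`, it is
`G`-equivariant onto `λ`. -/
def indToChar (lam : G →* kˣ) (s : G) : indCar H k ξ →ₗ[k] k where
  toFun f := f.1 1 + (lam s : k)⁻¹ * f.1 s
  map_add' f f' := by
    change f.1 1 + f'.1 1 + (lam s : k)⁻¹ * (f.1 s + f'.1 s) = _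
    ring
  map_smul' c f := by
    change c * f.1 1 + (lam s : k)⁻¹ * (c * f.1 s) = c * _
    ring

theorem indToChar_apply (lam : G →* kˣ) (s : G) (f : indCar H k ξ) :
    indToChar H ξ lam s f = f.1 1 + (lam s : k)⁻¹ * f.1 s := rfl

theorem indToChar_indRep (hidx : H.index = 2) {lam : G →* kˣ} (hlam : ∀ h : H, lam ↑h = ξ h)
    {s : G} (hs : s ∉ H) (g : G) (f : indCar H k ξ) :
    indToChar H ξ lam s (indRep H k ξ g f) = (lam g : k) * indToChar H ξ lam s f := by
  change f.1 (1 * g) + (lam s : k)⁻¹ * f.1 (s * g) = (lam g : k) * (f.1 1 + (lam s : k)⁻¹ * f.1 s)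
  have hne : (lam s : k) ≠ 0 := (lam s).ne_zero
  rw [one_mul]
  by_cases hg : g ∈ H
  · have hsg : s * g ∉ H := by rwa [H.mul_mem_cancel_right hg]
    rw [indCar_apply_of_mem hlam f hg, indCar_apply_of_notMem hidx hlam f hsg hs]
    simp only [map_mul, map_inv, Units.val_mul, Units.val_inv_eq_inv_val]
    field_simp
  · rw [indCar_apply_of_notMem hidx hlam f hg hs,
      indCar_apply_of_mem hlam f (mul_mem_of_notMem_of_index_two hidx hs hg)]
    simp only [map_mul, map_inv, Units.val_mul, Units.val_inv_eq_inv_val]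
    field_simp
    ring

/-- When `2 ≠ 0` in `k`, two extensions of `ξ` of opposite sign at `s ∉ H` split the induced
representation. -/
theorem repIso_indRep_charPairRep (hidx : H.index = 2) (h2 : (2 : k) ≠ 0) {lam₁ lam₂ : G →* kˣ}
    (hlam₁ : ∀ h : H, lam₁ ↑h = ξ h) (hlam₂ : ∀ h : H, lam₂ ↑h = ξ h) {s : G} (hs : s ∉ H)
    (hneg : lam₂ s = -lam₁ s) : RepIso (indRep H k ξ) (charPairRep k lam₁ lam₂) := by
  have hne : (lam₁ s : k) ≠ 0 := (lam₁ s).ne_zero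
  refine ⟨LinearEquiv.ofBijective
    ((indToChar H ξ lam₁ s).prod (indToChar H ξ lam₂ s)) ⟨?_, ?_⟩, fun g v => ?_⟩
  · rw [← LinearMap.ker_eq_bot, LinearMap.ker_eq_bot']
    intro f hf
    have e1 : f.1 1 + (lam₁ s : k)⁻¹ * f.1 s = 0 := congrArg Prod.fst hf
    have e2 : f.1 1 + (lam₂ s : k)⁻¹ * f.1 s = 0 := congrArg Prod.snd hf
    rw [hneg, Units.val_neg, inv_neg] at e2
    have f1 : f.1 1 = 0 :=
      (mul_eq_zero.1 (show (2 : k) * f.1 1 = 0 by linear_combination e1 + e2)).resolve_left h2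
    rw [f1, zero_add] at e1
    exact indCar_ext hidx hlam₁ hs f1 ((mul_eq_zero.1 e1).resolve_left (inv_ne_zero hne))
  · rintro ⟨a, b⟩
    refine ⟨(a / 2) • indCarOfChar lam₁ hlam₁ + (b / 2) • indCarOfChar lam₂ hlam₂, ?_⟩
    apply Prod.ext
    · change (a / 2 * ((lam₁ 1 : kˣ) : k) + b / 2 * ((lam₂ 1 : kˣ) : k)) +
        (lam₁ s : k)⁻¹ * (a / 2 * (lam₁ s : k) + b / 2 * (lam₂ s : k)) = a
      simp only [hneg, map_one, Units.val_one, Units.val_neg]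
      field_simp
      ring
    · change (a / 2 * ((lam₁ 1 : kˣ) : k) + b / 2 * ((lam₂ 1 : kˣ) : k)) +
        (lam₂ s : k)⁻¹ * (a / 2 * (lam₁ s : k) + b / 2 * (lam₂ s : k)) = b
      simp only [hneg, map_one, Units.val_one, Units.val_neg]
      field_simp
      ring
  · exact Prod.ext (indToChar_indRep hidx hlam₁ hs g v) (indToChar_indRep hidx hlam₂ hs g v)

theorem not_repIso_indRep_charPairRep_self {lam : G →* kˣ} {s : G} (hs : s ∉ H) :
    ¬ RepIso (indRep H k ξ) (charPairRep k lam lam) := by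
  rintro ⟨e, he⟩
  have h : indRep H k ξ s (indCarDelta H ξ) = (lam s : k) • indCarDelta H ξ := by
    apply e.injective
    rw [he, map_smul]
    rfl
  have h1 : (indCarDelta H ξ).1 (1 * s) = (lam s : k) * (indCarDelta H ξ).1 1 :=
    congrFun (congrArg Subtype.val h) 1
  rw [one_mul, indCarDelta_of_notMem hs, indCarDelta_one, mul_one] at h1
  exact (lam s).ne_zero h1.symm

/-- In characteristic 2, `Ind_H^G ξ` is a non-split extension of `λ` by itself, where `λ` is an
extension of `ξ` to `G`. -/
theorem exists_nonsplit_exact_indRep (hidx : H.index = 2) [CharP k 2] {lam : G →* kˣ}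
    (hlam : ∀ h : H, lam ↑h = ξ h) {s : G} (hs : s ∉ H) :
    ∃ (ι : k →ₗ[k] indCar H k ξ) (π : indCar H k ξ →ₗ[k] k),
      Function.Injective ι ∧ Function.Surjective π ∧
      LinearMap.range ι = LinearMap.ker π ∧
      (∀ (g : G) (c : k), ι ((lam g : k) * c) = indRep H k ξ g (ι c)) ∧
      (∀ (g : G) (v : indCar H k ξ), π (indRep H k ξ g v) = (lam g : k) * π v) ∧
      ¬ ∃ σ : k →ₗ[k] indCar H k ξ,
          (∀ (g : G) (c : k), σ ((lam g : k) * c) = indRep H k ξ g (σ c)) ∧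
          π.comp σ = LinearMap.id := by
  have hne : (lam s : k) ≠ 0 := (lam s).ne_zero
  refine ⟨LinearMap.toSpanSingleton k _ (indCarOfChar lam hlam), indToChar H ξ lam s,
    ?_, fun c => ⟨c • indCarDelta H ξ, ?_⟩, ?_, fun g c => ?_, indToChar_indRep hidx hlam hs, ?_⟩
  · intro a b hab
    have h : a * ((lam 1 : kˣ) : k) = b * ((lam 1 : kˣ) : k) :=
      congrFun (congrArg Subtype.val hab) 1
    simpa using h
  · rw [map_smul, indToChar_apply, indCarDelta_one, indCarDelta_of_notMem hs]
    simp
  · apply le_antisymm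
    · rintro _ ⟨c, rfl⟩
      rw [LinearMap.mem_ker]
      change c * ((lam 1 : kˣ) : k) + (lam s : k)⁻¹ * (c * (lam s : k)) = 0
      rw [map_one, Units.val_one, mul_one, mul_left_comm, inv_mul_cancel₀ hne, mul_one]
      exact CharTwo.add_self_eq_zero c
    · intro f hf
      rw [LinearMap.mem_ker, indToChar_apply, CharTwo.add_eq_zero] at hf
      refine ⟨f.1 1, indCar_ext hidx hlam hs ?_ ?_⟩
      · change f.1 1 * ((lam 1 : kˣ) : k) = _
        simp
      · change f.1 1 * (lam s : k) = _
        rw [hf]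
        field_simp
  · rw [LinearMap.toSpanSingleton_apply, LinearMap.toSpanSingleton_apply, map_smul,
      indRep_indCarOfChar, smul_smul, mul_comm]
  · rintro ⟨σ, hσ, hid⟩
    have h1 : (σ 1).1 1 + (lam s : k)⁻¹ * (σ 1).1 s = 1 := LinearMap.congr_fun hid 1
    have h2 : (lam s : k) * (σ 1).1 1 = (σ 1).1 (1 * s) := by
      have h := hσ s 1
      rw [← smul_eq_mul, map_smul] at h
      exact congrFun (congrArg Subtype.val h) 1
    rw [one_mul] at h2
    rw [← h2, inv_mul_cancel_left₀ hne, CharTwo.add_self_eq_zero] at h1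
    exact zero_ne_one h1

end IndexTwo

/-- Let `H` be an index-2 (hence normal) subgroup of `G`, `k` an algebraically closed field,
and `ξ : H → kˣ` an irregular character (invariant under conjugation by `G`).
If `char k ≠ 2`, then `Ind_H^G ξ ≅ λ₁ ⊕ λ₂` where `λ₁ ≠ λ₂` are the two extensions of `ξ`
to `G`.  If `char k = 2`, then `ξ` has a unique extension `λ` to `G` and there is a
non-split short exact sequence `0 → λ → Ind_H^G ξ → λ → 0`; in particular `Ind_H^G ξ`
is not semisimple (not isomorphic to `λ ⊕ λ`) and both composition factors equal `λ`. -/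
theorem stmt3 {G : Type*} [Group G] (H : Subgroup G) [hN : H.Normal] (hidx : H.index = 2)
    (k : Type*) [Field k] [IsAlgClosed k] (ξ : H →* kˣ)
    (hirr : ∀ (g : G) (h : H) (hm : g * ↑h * g⁻¹ ∈ H), ξ ⟨g * ↑h * g⁻¹, hm⟩ = ξ h) :
    (ringChar k ≠ 2 →
      ∃ lam₁ lam₂ : G →* kˣ, lam₁ ≠ lam₂ ∧
        (∀ h : H, lam₁ ↑h = ξ h) ∧ (∀ h : H, lam₂ ↑h = ξ h) ∧
        (∀ mu : G →* kˣ, (∀ h : H, mu ↑h = ξ h) → mu = lam₁ ∨ mu = lam₂) ∧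
        RepIso (indRep H k ξ) (charPairRep k lam₁ lam₂)) ∧
    (ringChar k = 2 →
      ∃ lam : G →* kˣ, (∀ h : H, lam ↑h = ξ h) ∧
        (∀ mu : G →* kˣ, (∀ h : H, mu ↑h = ξ h) → mu = lam) ∧
        (∃ (ι : k →ₗ[k] indCar H k ξ) (π : indCar H k ξ →ₗ[k] k),
          Function.Injective ι ∧ Function.Surjective π ∧
          LinearMap.range ι = LinearMap.ker π ∧
          (∀ (g : G) (c : k), ι ((lam g : k) * c) = indRep H k ξ g (ι c)) ∧
          (∀ (g : G) (v : indCar H k ξ), π (indRep H k ξ g v) = (lam g : k) * π v) ∧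
          ¬ ∃ s : k →ₗ[k] indCar H k ξ,
              (∀ (g : G) (c : k), s ((lam g : k) * c) = indRep H k ξ g (s c)) ∧
              π.comp s = LinearMap.id) ∧
        ¬ RepIso (indRep H k ξ) (charPairRep k lam lam)) := by
  obtain ⟨s, hs⟩ : ∃ s, s ∉ H := by
    by_contra! h
    rw [(Subgroup.eq_top_iff' H).2 h, Subgroup.index_top] at hidx
    omega
  have hss : s * s ∈ H := mul_mem_of_notMem_of_index_two hidx hs hs
  obtain ⟨c, hc⟩ := IsAlgClosed.exists_pow_nat_eq (ξ ⟨s * s, hss⟩ : k) two_pos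
  have hc0 : c ≠ 0 := by
    rintro rfl
    exact (ξ ⟨s * s, hss⟩).ne_zero (by simpa using hc.symm)
  obtain ⟨u, rfl⟩ := hc0.isUnit
  have hu : u * u = ξ ⟨s * s, hss⟩ := by
    ext
    rw [← hc, Units.val_mul, sq]
  have hsign (mu : G →* kˣ) (hmu : ∀ h : H, mu ↑h = ξ h) : mu s = u ∨ mu s = -u := by
    have h : mu s * mu s = u * u := by rw [hu, ← hmu, map_mul]
    simpa [Units.ext_iff] using mul_self_eq_mul_self_iff.1 (congrArg Units.val h)
  obtain ⟨lam₁, hlam₁, hu₁⟩ := exists_extension_of_index_two hidx hirr hs hss hu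
  obtain ⟨lam₂, hlam₂, hu₂⟩ :=
    exists_extension_of_index_two hidx hirr hs hss ((neg_mul_neg u u).trans hu)
  have heq (mu lam : G →* kˣ) (hmu : ∀ h : H, mu ↑h = ξ h) (hlam : ∀ h : H, lam ↑h = ξ h)
      (h : mu s = lam s) : mu = lam :=
    eq_of_eqOn_of_index_two hidx hs
      (fun h hh => (hmu ⟨h, hh⟩).trans (hlam ⟨h, hh⟩).symm) h
  constructor
  · intro hchar
    have h2 : (2 : k) ≠ 0 := Ring.two_ne_zero hchar
    refine ⟨lam₁, lam₂, ?_, hlam₁, hlam₂, fun mu hmu => ?_,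
      repIso_indRep_charPairRep hidx h2 hlam₁ hlam₂ hs (by rw [hu₁, hu₂])⟩
    · rintro rfl
      have h : (u : k) = -u := congrArg Units.val (hu₁.symm.trans hu₂)
      exact (mul_ne_zero h2 u.ne_zero) (by linear_combination h)
    · exact (hsign mu hmu).imp (fun h => heq _ _ hmu hlam₁ (h.trans hu₁.symm))
        (fun h => heq _ _ hmu hlam₂ (h.trans hu₂.symm))
  · intro hchar
    have : CharP k 2 := ringChar.of_eq hchar
    refine ⟨lam₁, hlam₁, fun mu hmu => heq _ _ hmu hlam₁ ?_,
      exists_nonsplit_exact_indRep hidx hlam₁ hs, not_repIso_indRep_charPairRep_self hs⟩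
    have hneg : -u = u := Units.ext (CharTwo.neg_eq (u : k))
    rw [hu₁]
    exact (hsign mu hmu).elim id (fun h => h.trans hneg)
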